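/- arXiv:1510.05532 — 3 statements merged into one kernel-verified Lean document; each statement's English description precedes it below -/
import Mathlib

section
/- Let T ⊆ 𝕏 be a measurable set, let f : 𝕏×𝕃 → [0,∞) be measurable, and let h be a nonnegative function on finite subsets of 𝕃. Then the set integral of the labeled multi-object exponential Δ(X) h(L(X)) f^X over the region T×𝕃 factorizes as a sum over label sets: ∑_{n=0}^∞ (1/n!) ∑_{ℓ₁,…,ℓₙ ∈ 𝕃} ∫_{Tⁿ} Δ({(x₁,ℓ₁),…,(xₙ,ℓₙ)}) h({ℓ₁,…,ℓₙ}) ∏_{i=1}^n f(xᵢ,ℓᵢ) d(x₁,…,xₙ) = ∑_{L ⊆ 𝕃 finite} h(L) ∏_{ℓ∈L} ∫_T f(x,ℓ) dx, where all sums and integrals are taken in [0,∞]. -/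
open MeasureTheory ENNReal

/-- The tuples enumerating a finite set of `n` elements without repetition are the bijections
from `Fin n` onto it. -/
noncomputable def injectiveImageEquiv {L : Type*} [DecidableEq L] (n : ℕ) (J : Finset L) :
    {v : Fin n → L // Function.Injective v ∧ Finset.image v Finset.univ = J} ≃ (Fin n ≃ J) where
  toFun v := Equiv.ofBijective
    (fun i => ⟨v.1 i, by
      have := Finset.mem_image_of_mem v.1 (Finset.mem_univ i)
      rwa [v.2.2] at this⟩)
    ⟨fun i j hij => v.2.1 (congrArg Subtype.val hij), fun ⟨y, hy⟩ => by
      rw [← v.2.2, Finset.mem_image] at hy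
      obtain ⟨i, -, rfl⟩ := hy
      exact ⟨i, rfl⟩⟩
  invFun e := ⟨fun i => e i, Subtype.val_injective.comp e.injective, by
    ext y
    simp only [Finset.mem_image, Finset.mem_univ, true_and]
    exact ⟨by rintro ⟨i, rfl⟩; exact (e i).2, fun hy => ⟨e.symm ⟨y, hy⟩, by simp⟩⟩⟩
  left_inv _ := rfl
  right_inv _ := by ext; rfl

theorem tsum_injective_image_eq {L : Type*} [DecidableEq L] (n : ℕ) (J : Finset L) (c : ℝ≥0∞) :
    ∑' v : Fin n → L,
      (if Function.Injective v ∧ Finset.image v Finset.univ = J then c else 0) =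
    if J.card = n then (n.factorial : ℝ≥0∞) * c else 0 := by
  classical
  have hsub : ∑' v : Fin n → L,
      (if Function.Injective v ∧ Finset.image v Finset.univ = J then c else 0) =
      ∑' _ : {v : Fin n → L // Function.Injective v ∧ Finset.image v Finset.univ = J}, c := by
    refine Eq.trans ?_ (tsum_subtype
      {v : Fin n → L | Function.Injective v ∧ Finset.image v Finset.univ = J} fun _ => c).symm
    simp only [Set.indicator_apply, Set.mem_ofPred_eq]
  rw [hsub, ← (injectiveImageEquiv n J).symm.tsum_eq, tsum_fintype, Finset.sum_const,
    Finset.card_univ, nsmul_eq_mul]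
  split_ifs with hJ
  · rw [Fintype.card_equiv (Fintype.equivOfCardEq (by simp [hJ])), Fintype.card_fin]
  · have : IsEmpty (Fin n ≃ J) := ⟨fun e => hJ (by simpa using (Fintype.card_congr e).symm)⟩
    simp

/-- A sum over finite sets is the sum over repetition-free tuples, weighted by inverse
factorials. -/
theorem tsum_inv_factorial_mul_tsum_injective {L : Type*} [DecidableEq L]
    (g : Finset L → ℝ≥0∞) :
    ∑' n : ℕ, (n.factorial : ℝ≥0∞)⁻¹ * ∑' v : Fin n → L,
      (if Function.Injective v then g (Finset.image v Finset.univ) else 0) = ∑' J, g J := by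
  have key (n : ℕ) : (n.factorial : ℝ≥0∞)⁻¹ * ∑' v : Fin n → L,
      (if Function.Injective v then g (Finset.image v Finset.univ) else 0) =
      ∑' J : Finset L, if n = J.card then g J else 0 := by
    have hsplit (v : Fin n → L) :
        (if Function.Injective v then g (Finset.image v Finset.univ) else 0) =
        ∑' J, if Function.Injective v ∧ Finset.image v Finset.univ = J then g J else 0 := by
      by_cases hv : Function.Injective v <;> simp [hv]
    simp_rw [hsplit]
    rw [ENNReal.tsum_comm, ← ENNReal.tsum_mul_left]
    refine tsum_congr fun J => ?_
    rw [tsum_injective_image_eq, mul_ite, mul_zero, ← mul_assoc,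
      ENNReal.inv_mul_cancel (by exact_mod_cast n.factorial_ne_zero) (by simp), one_mul]
    simp only [eq_comm]
  simp_rw [key]
  rw [ENNReal.tsum_comm]
  simp

/-- The integral over a finite power of a measure space of a product of functions of the separate
coordinates is the product of their integrals. -/
theorem lintegral_pi_fin_prod_eq_prod {X : Type*} [MeasurableSpace X] (μ : Measure X)
    [SigmaFinite μ] {n : ℕ} (g : Fin n → X → ℝ≥0∞) (hg : ∀ i, Measurable (g i)) :
    ∫⁻ x, ∏ i, g i (x i) ∂(Measure.pi fun _ => μ) = ∏ i, ∫⁻ x, g i x ∂μ := by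
  induction n with
  | zero => simp
  | succ n ih =>
    have hm : Measurable fun y : Fin n → X => ∏ i, g i.succ (y i) :=
      Finset.measurable_prod _ fun i _ => (hg _).comp (measurable_pi_apply i)
    rw [← ((measurePreserving_piFinSuccAbove (fun _ : Fin (n + 1) => μ) 0).symm).lintegral_comp_emb
      (MeasurableEquiv.measurableEmbedding _)]
    simp only [Fin.prod_univ_succ, MeasurableEquiv.piFinSuccAbove_symm_apply,
      Fin.insertNthEquiv_apply, Fin.insertNth_zero', Fin.cons_zero, Fin.cons_succ]
    rw [lintegral_prod_mul (hg 0).aemeasurable hm.aemeasurable, ih _ fun i => hg i.succ]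

/-- factorization of the set integral of a labeled multi-object
exponential `Δ(X) h(L(X)) f^X` over a region `T × 𝕃`, with all sums and
integrals taken in `[0,∞]`.  Finite subsets of `𝕏 × 𝕃` are represented by
tuples `(ℓs, xs)`, the distinct-label indicator `Δ` by the indicator that the
label tuple is injective, and `L(X)` by the image of the label tuple. -/
theorem set_integral_labeled_exponential_factorizes
    {d : ℕ} {L : Type*} [Countable L] [DecidableEq L]
    (T : Set (Fin d → ℝ)) (hT : MeasurableSet T)
    (f : (Fin d → ℝ) → L → ℝ) (hf0 : ∀ x ℓ, 0 ≤ f x ℓ)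
    (hfm : ∀ ℓ : L, Measurable fun x => f x ℓ)
    (h : Finset L → ℝ) (hh : ∀ J : Finset L, 0 ≤ h J) :
    ∑' n : ℕ, (Nat.factorial n : ℝ≥0∞)⁻¹ *
      ∑' ℓs : Fin n → L,
        ∫⁻ xs : Fin n → (Fin d → ℝ) in Set.univ.pi (fun _ => T),
          ENNReal.ofReal ((if Function.Injective ℓs then (1:ℝ) else 0) *
            h (Finset.image ℓs Finset.univ) * ∏ i, f (xs i) (ℓs i))
    = ∑' J : Finset L, ENNReal.ofReal (h J) *
        ∏ ℓ ∈ J, ∫⁻ x in T, ENNReal.ofReal (f x ℓ) := by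
  rw [← tsum_inv_factorial_mul_tsum_injective]
  refine tsum_congr fun n => ?_
  congr 1
  refine tsum_congr fun v => ?_
  split_ifs with hv
  · simp_rw [one_mul, ENNReal.ofReal_mul (hh _)]
    simp_rw [ENNReal.ofReal_prod_of_nonneg fun i _ => hf0 _ (v i)]
    rw [lintegral_const_mul' _ _ ENNReal.ofReal_ne_top, Finset.prod_image fun i _ j _ hij => hv hij,
      volume_pi, Measure.restrict_pi_pi]
    congr 1
    exact lintegral_pi_fin_prod_eq_prod _ _ fun i => (hfm (v i)).ennreal_ofReal
  · simp
end

section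
/- (Cardinality distribution of a GLMB.) Let π be a GLMB density. For every n ∈ ℕ, the probability that a realization has exactly n points, given by the n-th term of the set integral, (1/n!) ∑_{ℓ₁,…,ℓₙ ∈ 𝕃} ∫_{𝕏ⁿ} π({(x₁,ℓ₁),…,(xₙ,ℓₙ)}) d(x₁,…,xₙ), equals ∑_{c∈ℂ} ∑_{L⊆𝕃, |L|=n} w^(c)(L). -/
open MeasureTheory ENNReal

/-- Tonelli's theorem for a product of functions of separate variables. -/
theorem lintegral_fin_prod_eq_prod {E : Type*} [MeasureSpace E]
    [SigmaFinite (volume : Measure E)] {n : ℕ} {f : Fin n → E → ℝ≥0∞}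
    (hf : ∀ i, Measurable (f i)) :
    ∫⁻ x : Fin n → E, ∏ i, f i (x i) = ∏ i, ∫⁻ x, f i x := by
  induction n with
  | zero => simp [volume_pi]
  | succ n ih =>
    rw [← (volume_preserving_piFinSuccAbove (fun _ : Fin (n + 1) => E) 0).symm.lintegral_comp_emb
      (MeasurableEquiv.measurableEmbedding _)]
    simp only [MeasurableEquiv.piFinSuccAbove_symm_apply, Fin.insertNthEquiv,
      Fin.prod_univ_succ, Fin.insertNth_zero, Equiv.coe_fn_mk, Fin.cons_zero, Fin.cons_succ]
    rw [← ih fun i => hf i.succ]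
    exact lintegral_prod_mul (μ := volume) (ν := volume) (f := f 0) (g := fun y : Fin n → E => ∏ i, f i.succ (y i))
      (hf 0).aemeasurable
      (Finset.measurable_prod _ fun i _ => (hf i.succ).comp (measurable_pi_apply i)).aemeasurable

/-- A set of size `n` has `n!` enumerations by `Fin n`. -/
theorem card_injective_image_eq {L : Type*} [DecidableEq L] {n : ℕ} {J : Finset L}
    (hJ : J.card = n) :
    ENat.card {f : Fin n → L // Function.Injective f ∧ Finset.image f Finset.univ = J} =
      n.factorial := by
  let e : {f : Fin n → L // Function.Injective f ∧ Finset.image f Finset.univ = J} ≃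
      (Fin n ≃ J) :=
    { toFun := fun f => Equiv.ofBijective
        (fun i => ⟨f.1 i, f.2.2.le (Finset.mem_image_of_mem f.1 (Finset.mem_univ i))⟩)
        ⟨fun i j h => f.2.1 (congrArg Subtype.val h), fun ⟨x, hx⟩ => by
          obtain ⟨i, -, hi⟩ := Finset.mem_image.1 (f.2.2.ge hx)
          exact ⟨i, Subtype.ext hi⟩⟩
      invFun := fun g => ⟨fun i => g i, Subtype.val_injective.comp g.injective, by
        ext x
        simp only [Finset.mem_image, Finset.mem_univ, true_and]
        exact ⟨fun ⟨i, hi⟩ => hi ▸ (g i).2, fun hx => ⟨g.symm ⟨x, hx⟩, by simp⟩⟩⟩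
      left_inv := fun f => rfl
      right_inv := fun g => by ext; rfl }
  rw [ENat.card_congr e, ENat.card_eq_coe_fintype_card,
    Fintype.card_equiv (J.equivFinOfCardEq hJ).symm, Fintype.card_fin]

/-- Summing a set function over injective enumerations counts every set of size `n` exactly
`n!` times. -/
theorem tsum_injective_image {L : Type*} [DecidableEq L] (n : ℕ) (F : Finset L → ℝ≥0∞)
    [DecidablePred fun f : Fin n → L => Function.Injective f] :
    ∑' f : Fin n → L, (if Function.Injective f then F (Finset.image f Finset.univ) else 0) =
      n.factorial * ∑' J : Finset L, if J.card = n then F J else 0 := by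
  classical
  have fiber (f : Fin n → L) :
      (if Function.Injective f then F (Finset.image f Finset.univ) else 0) =
        ∑' J, if Function.Injective f ∧ Finset.image f Finset.univ = J then F J else 0 := by
    rw [tsum_eq_single (Finset.image f Finset.univ) fun J hJ => if_neg fun h => hJ h.2.symm]
    simp
  simp_rw [fiber]
  rw [ENNReal.tsum_comm, ← ENNReal.tsum_mul_left]
  refine tsum_congr fun J => ?_
  split_ifs with hJ
  · have indicator_eq : (fun f : Fin n → L =>
        if Function.Injective f ∧ Finset.image f Finset.univ = J then F J else 0) =
        Set.indicator {f | Function.Injective f ∧ Finset.image f Finset.univ = J}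
          fun _ => F J := by
      ext f
      simp [Set.indicator_apply]
    rw [indicator_eq, ← tsum_subtype, ENNReal.tsum_const]
    have := card_injective_image_eq hJ
    simp only [Set.coe_ofPred, this]
    simp
  · rw [mul_zero, ENNReal.tsum_eq_zero]
    refine fun f => if_neg fun ⟨hf, h⟩ => hJ ?_
    rw [← h, Finset.card_image_of_injective _ hf, Finset.card_univ, Fintype.card_fin]

/-- Integrating a GLMB density over the states leaves only the weights of the label set. -/
theorem lintegral_glmb_slice {E L ι : Type*} [MeasureSpace E]
    [SigmaFinite (volume : Measure E)] [Fintype ι]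
    {v : ι → ℝ} (hv : ∀ c, 0 ≤ v c) {p : ι → E → L → ℝ}
    (hp0 : ∀ c x ℓ, 0 ≤ p c x ℓ) (hpm : ∀ c ℓ, Measurable fun x => p c x ℓ)
    (hp1 : ∀ c ℓ, ∫⁻ x, ENNReal.ofReal (p c x ℓ) = 1) {n : ℕ} {ℓs : Fin n → L}
    {P : Prop} [Decidable P] :
    ∫⁻ xs : Fin n → E, ENNReal.ofReal ((if P then (1 : ℝ) else 0) *
        ∑ c, v c * ∏ i, p c (xs i) (ℓs i)) =
      if P then ∑ c, ENNReal.ofReal (v c) else 0 := by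
  split_ifs
  · have expand (xs : Fin n → E) : ENNReal.ofReal (1 * ∑ c, v c * ∏ i, p c (xs i) (ℓs i)) =
        ∑ c, ENNReal.ofReal (v c) * ∏ i, ENNReal.ofReal (p c (xs i) (ℓs i)) := by
      rw [one_mul, ENNReal.ofReal_sum_of_nonneg fun c _ =>
        mul_nonneg (hv c) (Finset.prod_nonneg fun i _ => hp0 _ _ _)]
      refine Finset.sum_congr rfl fun c _ => ?_
      rw [ENNReal.ofReal_mul (hv c), ENNReal.ofReal_prod_of_nonneg fun i _ => hp0 _ _ _]
    have meas (c : ι) : Measurable fun xs : Fin n → E =>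
        ∏ i, ENNReal.ofReal (p c (xs i) (ℓs i)) :=
      Finset.measurable_prod _ fun i _ =>
        ((hpm c (ℓs i)).comp (measurable_pi_apply i)).ennreal_ofReal
    simp_rw [expand]
    rw [lintegral_finsetSum _ fun c _ => (meas c).const_mul _]
    refine Finset.sum_congr rfl fun c _ => ?_
    rw [lintegral_const_mul _ (meas c), lintegral_fin_prod_eq_prod
      (f := fun i x => ENNReal.ofReal (p c x (ℓs i))) fun i => (hpm c (ℓs i)).ennreal_ofReal]
    simp [hp1]
  · simp

/-- cardinality distribution of a GLMB.  For a GLMB density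
`π(X) = Δ(X) ∑_c w⁽ᶜ⁾(L(X)) [p⁽ᶜ⁾]^X` and every `n ∈ ℕ`, the `n`-th term of
the set integral of `π` equals `∑_{c∈ℂ} ∑_{L⊆𝕃, |L|=n} w⁽ᶜ⁾(L)`. -/
theorem glmb_cardinality_distribution
    {d : ℕ} {L ι : Type*} [Countable L] [DecidableEq L] [Fintype ι]
    (w : ι → Finset L → ℝ) (hw : ∀ c J, 0 ≤ w c J)
    (p : ι → (Fin d → ℝ) → L → ℝ)
    (hp0 : ∀ c x ℓ, 0 ≤ p c x ℓ)
    (hpm : ∀ c ℓ, Measurable fun x => p c x ℓ)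
    (hp1 : ∀ c ℓ, ∫⁻ x, ENNReal.ofReal (p c x ℓ) = 1)
    (hwsum : ∑' J : Finset L, ∑ c, ENNReal.ofReal (w c J) = 1)
    (n : ℕ) :
    (Nat.factorial n : ℝ≥0∞)⁻¹ *
      ∑' ℓs : Fin n → L,
        ∫⁻ xs : Fin n → (Fin d → ℝ),
          ENNReal.ofReal ((if Function.Injective ℓs then (1:ℝ) else 0) *
            ∑ c, w c (Finset.image ℓs Finset.univ) * ∏ i, p c (xs i) (ℓs i))
    = ∑ c, ∑' J : Finset L,
        (if J.card = n then ENNReal.ofReal (w c J) else 0) := by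
  simp_rw [lintegral_glmb_slice (fun c => hw c _) hp0 hpm hp1]
  rw [tsum_injective_image n fun J => ∑ c, ENNReal.ofReal (w c J), ← mul_assoc,
    ENNReal.inv_mul_cancel (by exact_mod_cast n.factorial_ne_zero) (ENNReal.natCast_ne_top _),
    one_mul, ← Summable.tsum_finsetSum fun _ _ => ENNReal.summable]
  refine tsum_congr fun J => ?_
  split_ifs <;> simp
end

section
/- (Cauchy-Schwarz divergence between Poisson point processes.) Let u, v : 𝕏 → [0,∞) be measurable intensity functions that are both integrable and square-integrable on 𝕏 = ℝ^d, not both almost everywhere zero in a way making the denominators vanish (the inner products below are always strictly positive), and let π_u(X) = e^{−⟨1,u⟩} u^X and π_v(X) = e^{−⟨1,v⟩} v^X be the corresponding Poisson belief densities. Then with K = 1, the Cauchy-Schwarz divergence D_CS(π_u, π_v) = −ln( ∫ π_u(X)π_v(X) δX / √( ∫ π_u²(X) δX · ∫ π_v²(X) δX ) ) equals half the squared L²-distance between the intensity functions: D_CS(π_u, π_v) = (1/2) ∫_𝕏 (u(x) − v(x))² dx. -/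
open MeasureTheory ENNReal

/-- The set integral of a scaled power functional `X ↦ c * f^X` is `c * exp (∫ f)`. -/
theorem toReal_setIntegral_const_mul_prod {E : Type*} [MeasureSpace E]
    [SigmaFinite (volume : Measure E)] {f : E → ℝ} (hf0 : ∀ x, 0 ≤ f x) (hf : Integrable f)
    {c : ℝ} (hc : 0 ≤ c) :
    (∑' n : ℕ, (Nat.factorial n : ℝ≥0∞)⁻¹ *
      ∫⁻ xs : Fin n → E, ENNReal.ofReal (c * ∏ i, f (xs i))).toReal
    = c * Real.exp (∫ x, f x) := by
  have hterm (n : ℕ) : (Nat.factorial n : ℝ≥0∞)⁻¹ *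
      ∫⁻ xs : Fin n → E, ENNReal.ofReal (c * ∏ i, f (xs i))
      = ENNReal.ofReal (c * ((∫ x, f x) ^ n / (Nat.factorial n : ℝ))) := by
    have hint : Integrable (fun xs : Fin n → E => c * ∏ i, f (xs i)) :=
      (Integrable.fintype_prod (f := fun _ : Fin n => f) fun _ => hf).const_mul c
    rw [← ofReal_integral_eq_lintegral_ofReal hint
      (.of_forall fun xs => mul_nonneg hc (Finset.prod_nonneg fun i _ => hf0 _)),
      integral_const_mul, integral_fintype_prod_volume_eq_pow, Fintype.card_fin,
      ← ENNReal.ofReal_natCast, ← ENNReal.ofReal_inv_of_pos (by positivity),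
      ← ENNReal.ofReal_mul (by positivity)]
    congr 1
    ring
  have hpos : 0 ≤ ∫ x, f x := integral_nonneg hf0
  have hsum : HasSum (fun n : ℕ => c * ((∫ x, f x) ^ n / (Nat.factorial n : ℝ)))
      (c * Real.exp (∫ x, f x)) := by
    rw [Real.exp_eq_exp_ℝ]
    exact (NormedSpace.expSeries_div_hasSum_exp (∫ x, f x)).mul_left c
  rw [tsum_congr hterm, ← ENNReal.ofReal_tsum_of_nonneg (fun n => by positivity) hsum.summable,
    hsum.tsum_eq, ENNReal.toReal_ofReal (by positivity)]

/-- The inner product of two Poisson belief densities. -/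
theorem toReal_setIntegral_poisson_mul_poisson {E : Type*} [MeasureSpace E]
    [SigmaFinite (volume : Measure E)] {u v : E → ℝ} (hu0 : ∀ x, 0 ≤ u x) (hv0 : ∀ x, 0 ≤ v x)
    (huv : Integrable (fun x => u x * v x)) :
    (∑' n : ℕ, (Nat.factorial n : ℝ≥0∞)⁻¹ *
      ∫⁻ xs : Fin n → E, ENNReal.ofReal ((Real.exp (-∫ x, u x) * ∏ i, u (xs i)) *
        (Real.exp (-∫ x, v x) * ∏ i, v (xs i)))).toReal
    = Real.exp ((∫ x, u x * v x) - (∫ x, u x) - ∫ x, v x) := by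
  simp_rw [mul_mul_mul_comm (Real.exp _), ← Finset.prod_mul_distrib]
  rw [toReal_setIntegral_const_mul_prod (fun x => mul_nonneg (hu0 x) (hv0 x)) huv (by positivity),
    ← Real.exp_add, ← Real.exp_add]
  congr 1
  ring

/-- the Cauchy-Schwarz divergence between two Poisson point
processes with integrable and square-integrable intensity functions `u`, `v`
equals half the squared `L²`-distance between the intensities:
`D_CS(π_u, π_v) = (1/2) ∫ (u(x) − v(x))² dx` (with unit hyper-volume `K = 1`).
The set integrals `∫ π_u π_v δX`, `∫ π_u² δX`, `∫ π_v² δX` are expressed via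
tuples; the inner products below are always strictly positive. -/
theorem poisson_cauchy_schwarz_divergence
    {d : ℕ} (u v : (Fin d → ℝ) → ℝ)
    (hu0 : ∀ x, 0 ≤ u x) (hv0 : ∀ x, 0 ≤ v x)
    (hum : Measurable u) (hvm : Measurable v)
    (hui : Integrable u) (hvi : Integrable v)
    (hu2 : Integrable (fun x => u x ^ 2)) (hv2 : Integrable (fun x => v x ^ 2)) :
    -Real.log
      ((∑' n : ℕ, (Nat.factorial n : ℝ≥0∞)⁻¹ *
          ∫⁻ xs : Fin n → (Fin d → ℝ),
            ENNReal.ofReal ((Real.exp (-∫ x, u x) * ∏ i, u (xs i)) *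
              (Real.exp (-∫ x, v x) * ∏ i, v (xs i)))).toReal /
        Real.sqrt
          ((∑' n : ℕ, (Nat.factorial n : ℝ≥0∞)⁻¹ *
              ∫⁻ xs : Fin n → (Fin d → ℝ),
                ENNReal.ofReal ((Real.exp (-∫ x, u x) * ∏ i, u (xs i)) ^ 2)).toReal *
           (∑' n : ℕ, (Nat.factorial n : ℝ≥0∞)⁻¹ *
              ∫⁻ xs : Fin n → (Fin d → ℝ),
                ENNReal.ofReal ((Real.exp (-∫ x, v x) * ∏ i, v (xs i)) ^ 2)).toReal))
    = (1 / 2) * ∫ x, (u x - v x) ^ 2 := by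
  have huv : Integrable (fun x => u x * v x) := by
    refine (hu2.add hv2).mono' (hum.mul hvm).aestronglyMeasurable (.of_forall fun x => ?_)
    rw [Real.norm_of_nonneg (mul_nonneg (hu0 x) (hv0 x))]
    simp only [Pi.add_apply]
    nlinarith [sq_nonneg (u x - v x), sq_nonneg (u x), sq_nonneg (v x)]
  have hdist : ∫ x, (u x - v x) ^ 2
      = (∫ x, u x * u x) + (∫ x, v x * v x) - 2 * ∫ x, u x * v x := by
    simp only [sq] at hu2 hv2
    rw [← integral_add hu2 hv2, ← integral_const_mul,
      ← integral_sub (by exact hu2.add hv2) (huv.const_mul 2)]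
    congr 1 with x
    ring
  simp only [sq (_ * _)]
  simp only [sq] at hu2 hv2
  rw [toReal_setIntegral_poisson_mul_poisson hu0 hv0 huv,
    toReal_setIntegral_poisson_mul_poisson hu0 hu0 hu2,
    toReal_setIntegral_poisson_mul_poisson hv0 hv0 hv2, ← Real.exp_add,
    Real.log_div (Real.exp_ne_zero _) (Real.sqrt_ne_zero'.2 (Real.exp_pos _)),
    Real.log_sqrt (Real.exp_pos _).le, Real.log_exp, Real.log_exp, hdist]
  ring
end
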